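/- If (ω,x,y) is a maximal solution of the system with ω > 0, x(t₀) > 1 and x'(t₀) > 0 at some t₀ ∈ (S,T), then ∫_{t₀}^{T} ω(σ)dσ < ∞. -/

import Mathlib

open Real Set MeasureTheory

lemma aux_mono {f f' : ℝ → ℝ} {a b : ℝ} (hab : a ≤ b)
    (hf : ∀ t, a ≤ t → t ≤ b → HasDerivAt f (f' t) t)
    (h0 : ∀ t, a ≤ t → t ≤ b → 0 ≤ f' t) : f a ≤ f b := by
  have : MonotoneOn f (Icc a b) := by
    apply monotoneOn_of_hasDerivWithinAt_nonneg (f' := f') (convex_Icc a b)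
    · intro t ht
      exact (hf t ht.1 ht.2).continuousAt.continuousWithinAt
    · intro t ht
      have ht := interior_subset ht
      exact (hf t ht.1 ht.2).hasDerivWithinAt
    · intro t ht
      have ht := interior_subset ht
      exact h0 t ht.1 ht.2
  exact this ⟨le_refl _, hab⟩ ⟨hab, le_refl _⟩ hab

/-- Positivity of the derivative of x is preserved on a compact interval. -/
lemma aux_pos {x z p : ℝ → ℝ} {k a b : ℝ} (hk : 0 < k) (hab : a ≤ b)
    (hx : ∀ t, a ≤ t → t ≤ b → HasDerivAt x (z t) t)
    (hz : ∀ t, a ≤ t → t ≤ b → HasDerivAt z (z t * p t + k * (x t * (x t ^ 2 - 1))) t)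
    (hxa : 1 < x a) (hza : 0 < z a) : 0 < z b := by
  by_contra hcon
  push Not at hcon
  have hzc : ContinuousOn z (Icc a b) := fun t ht =>
    (hz t ht.1 ht.2).continuousAt.continuousWithinAt
  let A : Set ℝ := Icc a b ∩ z ⁻¹' Iic 0
  have hAcl : IsClosed A := hzc.preimage_isClosed_of_isClosed isClosed_Icc isClosed_Iic
  have hAne : A.Nonempty := ⟨b, ⟨hab, le_refl _⟩, hcon⟩
  have hAbdd : BddBelow A := ⟨a, fun t ht => ht.1.1⟩
  have hs : sInf A ∈ A := hAcl.csInf_mem hAne hAbdd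
  set s := sInf A with hsdef
  have hlt : ∀ t, a ≤ t → t < s → 0 < z t := by
    intro t h1 h2
    by_contra h3
    push Not at h3
    have : t ∈ A := ⟨⟨h1, h2.le.trans hs.1.2⟩, h3⟩
    exact absurd (csInf_le hAbdd this) (not_le.mpr h2)
  have has : a < s := by
    rcases hs.1.1.lt_or_eq with h | h
    · exact h
    · exfalso
      have h2 : z s ≤ 0 := hs.2
      rw [← h] at h2
      linarith
  have hzs : z s = 0 := by
    apply le_antisymm hs.2
    have hc : Filter.Tendsto z (nhdsWithin s (Iio s)) (nhds (z s)) :=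
      (hz s hs.1.1 hs.1.2).continuousAt.tendsto.mono_left nhdsWithin_le_nhds
    apply ge_of_tendsto hc
    filter_upwards [Ioo_mem_nhdsLT has] with t ht
    exact (hlt t ht.1.le ht.2).le
  have hxs : x a ≤ x s := by
    apply aux_mono has.le (fun t h1 h2 => hx t h1 (h2.trans hs.1.2))
    intro t h1 h2
    rcases h2.lt_or_eq with h | h
    · exact (hlt t h1 h).le
    · rw [h, hzs]
  have hd := hz s hs.1.1 hs.1.2
  have hdp : deriv z s > 0 := by
    rw [hd.deriv, hzs]
    have h1 : 1 < x s := lt_of_lt_of_le hxa hxs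
    have : 0 < x s ^ 2 - 1 := by nlinarith
    have : 0 < k * (x s * (x s ^ 2 - 1)) := by positivity
    linarith
  have hev := eventually_nhdsWithin_sign_eq_of_deriv_pos hdp hzs
  have hev2 := (hev.filter_mono (nhdsWithin_le_nhds (s := Iio s))).and (Ioo_mem_nhdsLT has)
  obtain ⟨t, ht1, ht2⟩ := hev2.exists
  rw [sign_pos (hlt t ht2.1.le ht2.2), sign_neg (by linarith [ht2.2])] at ht1
  exact absurd ht1 (by decide)

/-- Integrability from an eventually valid bound on an antiderivative. -/
lemma aux_int {ω G G' : ℝ → ℝ} {T : EReal} {t₁ : ℝ} (ht₁ : (t₁ : EReal) < T)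
    (hω : ∀ t : ℝ, t₁ ≤ t → (t : EReal) < T → ContinuousAt ω t)
    (hω0 : ∀ t : ℝ, t₁ ≤ t → (t : EReal) < T → 0 ≤ ω t)
    (hG : ∀ t : ℝ, t₁ ≤ t → (t : EReal) < T → HasDerivAt G (G' t) t)
    (hG0 : ∀ t : ℝ, t₁ ≤ t → (t : EReal) < T → 0 ≤ G t)
    (hle : ∀ t : ℝ, t₁ ≤ t → (t : EReal) < T → ω t ≤ - G' t) :
    IntegrableOn ω {t : ℝ | t₁ < t ∧ (t : EReal) < T} volume := by
  have hlt : ∀ {s t : ℝ}, s ≤ t → (t : EReal) < T → (s : EReal) < T := fun h1 h2 =>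
    lt_of_le_of_lt (EReal.coe_le_coe_iff.mpr h1) h2
  have hI : ∀ b : ℝ, (b : EReal) < T → IntegrableOn ω (Icc t₁ b) := by
    intro b hb
    apply ContinuousOn.integrableOn_Icc
    intro t ht
    exact (hω t ht.1 (hlt ht.2 hb)).continuousWithinAt
  have hIoc : ∀ b : ℝ, (b : EReal) < T → IntegrableOn ω (Ioc t₁ b) := fun b hb =>
    (hI b hb).mono_set Ioc_subset_Icc_self
  have hbd : ∀ b : ℝ, t₁ ≤ b → (b : EReal) < T → ∫ t in t₁..b, ‖ω t‖ ≤ G t₁ := by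
    intro b hb hbT
    have h1 : ∫ t in t₁..b, ‖ω t‖ ≤ (fun t => - G t) b - (fun t => - G t) t₁ := by
      apply intervalIntegral.integral_le_sub_of_hasDeriv_right_of_le (g' := fun t => - G' t) hb
      · intro t ht
        exact (hG t ht.1 (hlt ht.2 hbT)).neg.continuousAt.continuousWithinAt
      · intro t ht
        exact (hG t ht.1.le (hlt ht.2.le hbT)).neg.hasDerivWithinAt
      · exact (hI b hbT).norm
      · intro t ht
        rw [Real.norm_of_nonneg (hω0 t ht.1.le (hlt ht.2.le hbT))]
        exact hle t ht.1.le (hlt ht.2.le hbT)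
    have h2 := hG0 b hb hbT
    simp only at h1
    linarith
  induction T using EReal.rec with
  | bot => simp at ht₁
  | top =>
    have := integrableOn_Ioi_of_intervalIntegral_norm_bounded (f := ω) (μ := volume)
      (l := Filter.atTop) (b := fun r : ℝ => r) (G t₁) t₁
      (fun i => hIoc i (EReal.coe_lt_top i)) Filter.tendsto_id
      (by filter_upwards [Filter.eventually_ge_atTop t₁] with b hb
          exact hbd b hb (EReal.coe_lt_top b))
    refine this.mono_set ?_
    intro t ht
    exact ht.1
  | coe r =>
    have hr : t₁ < r := EReal.coe_lt_coe_iff.mp ht₁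
    have hb : ∀ k : ℕ, r - 1 / ((k : ℝ) + 1) < r := by
      intro k
      have : 0 < 1 / ((k : ℝ) + 1) := by positivity
      linarith
    have htend : Filter.Tendsto (fun k : ℕ => r - 1 / ((k : ℝ) + 1)) Filter.atTop (nhds r) := by
      have h := (tendsto_const_nhds (x := r) (f := Filter.atTop (α := ℕ))).sub
        (tendsto_one_div_add_atTop_nhds_zero_nat (𝕜 := ℝ))
      rwa [sub_zero] at h
    have := integrableOn_Ioc_of_intervalIntegral_norm_bounded_right (f := ω) (I := G t₁)
      (a := t₁) (l := Filter.atTop) (b := fun k : ℕ => r - 1 / ((k : ℝ) + 1))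
      (fun i => hIoc _ (EReal.coe_lt_coe_iff.mpr (hb i))) htend
      (by filter_upwards [htend.eventually (lt_mem_nhds hr)] with k hk
          rw [← intervalIntegral.integral_of_le hk.le]
          exact hbd _ hk.le (EReal.coe_lt_coe_iff.mpr (hb k)))
    refine this.mono_set ?_
    intro t ht
    exact ⟨ht.1, (EReal.coe_lt_coe_iff.mp ht.2).le⟩

/-- The key algebraic inequality. -/
lemma aux_alg {N X Y u z : ℝ} (hN : 2 ≤ N) (hX : 3 ≤ X) (hu : 0 ≤ u)
    (hz : z = X ^ 2 - X * Y + N - 1 - u) (hz0 : 0 < z) (hz2 : z ≤ 2 * X ^ 2) :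
    X / 2 ≤ (z * (3 * X - Y) + (N - 1) * (X * (X ^ 2 - 1))) / X ^ 2 - 2 * z ^ 2 / X ^ 3 := by
  have hXp : 0 < X := by linarith
  have key : X ^ 4 / 2 ≤ X * (z * (3 * X - Y) + (N - 1) * (X * (X ^ 2 - 1))) - 2 * z ^ 2 := by
    have e : X * (z * (3 * X - Y) + (N - 1) * (X * (X ^ 2 - 1))) - 2 * z ^ 2
        = z * (2 * X ^ 2 - z) + u * z + (N - 1) * (X ^ 4 - X ^ 2 - z) := by
      have : X * Y = X ^ 2 + N - 1 - u - z := by linarith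
      linear_combination (-z) * this
    rw [e]
    have h1 : 0 ≤ z * (2 * X ^ 2 - z) := mul_nonneg hz0.le (by linarith)
    have h2 : 0 ≤ u * z := by positivity
    have h9 : 9 ≤ X ^ 2 := by nlinarith
    have h3 : X ^ 4 / 2 ≤ X ^ 4 - X ^ 2 - z := by nlinarith
    have h4 : 0 ≤ X ^ 4 := by positivity
    nlinarith
  have e2 : (z * (3 * X - Y) + (N - 1) * (X * (X ^ 2 - 1))) / X ^ 2 - 2 * z ^ 2 / X ^ 3
      = (X * (z * (3 * X - Y) + (N - 1) * (X * (X ^ 2 - 1))) - 2 * z ^ 2) / X ^ 3 := by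
    field_simp
  rw [e2, le_div_iff₀ (by positivity)]
  nlinarith



/-- If `(ω, x, y)` is a maximal solution on `(S,T)` of the system
`ω' = xω`, `x' = x² - xy + n - 1 - λω²`, `y' = xy - nx² - λω²` with `ω > 0`, and
`x(t₀) > 1`, `x'(t₀) > 0` at some `t₀ ∈ (S,T)`, then `∫_{t₀}^{T} ω(σ) dσ < ∞`.
Maximality is encoded by: if `T < ∞` then `x` is unbounded on `(t₀, T)` (bounds on `x`
imply bounds on the derivatives of `ω` and `y`, so escape can only occur through `x`).
Here `S, T : EReal` may be infinite. -/
theorem stmt14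
    (n : ℕ) (hn : 2 ≤ n) (lam : ℝ) (hlam : 0 < lam)
    (S T : EReal) (ω x y : ℝ → ℝ)
    (hsys : ∀ t : ℝ, S < (t : EReal) → (t : EReal) < T →
      HasDerivAt ω (x t * ω t) t ∧
      HasDerivAt x ((x t) ^ 2 - x t * y t + (n : ℝ) - 1 - lam * (ω t) ^ 2) t ∧
      HasDerivAt y (x t * y t - (n : ℝ) * (x t) ^ 2 - lam * (ω t) ^ 2) t)
    (hωpos : ∀ t : ℝ, S < (t : EReal) → (t : EReal) < T → 0 < ω t)
    (t₀ : ℝ) (ht₀S : S < (t₀ : EReal)) (ht₀T : (t₀ : EReal) < T)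
    -- maximality of the interval of existence:
    (hmax : T ≠ ⊤ → ∀ M : ℝ, ∃ t : ℝ, t₀ < t ∧ (t : EReal) < T ∧ M < |x t|)
    (hx1 : 1 < x t₀) (hx'0 : 0 < deriv x t₀) :
    IntegrableOn ω {t : ℝ | t₀ < t ∧ (t : EReal) < T} volume := by
  have hlt : ∀ {s t : ℝ}, s ≤ t → (t : EReal) < T → (s : EReal) < T := fun h1 h2 =>
    lt_of_le_of_lt (EReal.coe_le_coe_iff.mpr h1) h2
  have hS : ∀ {t : ℝ}, t₀ ≤ t → S < (t : EReal) := fun h =>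
    lt_of_lt_of_le ht₀S (EReal.coe_le_coe_iff.mpr h)
  obtain ⟨N, hNdef⟩ : ∃ N : ℝ, N = (n : ℝ) := ⟨_, rfl⟩
  have hN : 2 ≤ N := by rw [hNdef]; exact_mod_cast hn
  rw [← hNdef] at hsys
  obtain ⟨z, hzdef⟩ : ∃ z : ℝ → ℝ, z = fun t => (x t) ^ 2 - x t * y t + N - 1 - lam * (ω t) ^ 2 :=
    ⟨_, rfl⟩
  have hzt : ∀ t, z t = (x t) ^ 2 - x t * y t + N - 1 - lam * (ω t) ^ 2 := fun t => by rw [hzdef]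
  have hω : ∀ t : ℝ, t₀ ≤ t → (t : EReal) < T → HasDerivAt ω (x t * ω t) t := fun t h1 h2 =>
    (hsys t (hS h1) h2).1
  have hx : ∀ t : ℝ, t₀ ≤ t → (t : EReal) < T → HasDerivAt x (z t) t := fun t h1 h2 => by
    rw [hzt]; exact (hsys t (hS h1) h2).2.1
  have hy : ∀ t : ℝ, t₀ ≤ t → (t : EReal) < T →
      HasDerivAt y (x t * y t - N * (x t) ^ 2 - lam * (ω t) ^ 2) t := fun t h1 h2 =>
    (hsys t (hS h1) h2).2.2
  have hz : ∀ t : ℝ, t₀ ≤ t → (t : EReal) < T →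
      HasDerivAt z (z t * (3 * x t - y t) + (N - 1) * (x t * (x t ^ 2 - 1))) t := by
    intro t h1 h2
    have h := (((((hx t h1 h2).pow 2).sub ((hx t h1 h2).mul (hy t h1 h2))).add_const N).sub_const
      1).sub (((hω t h1 h2).pow 2).const_mul lam)
    have e : z = fun t => (x t) ^ 2 - x t * y t + N - 1 - lam * (ω t) ^ 2 := hzdef
    rw [e]
    refine h.congr_deriv ?_
    simp only [hzt]
    norm_num
    ring
  have hz0 : 0 < z t₀ := by rwa [(hx t₀ le_rfl ht₀T).deriv] at hx'0
  have hzpos : ∀ t : ℝ, t₀ ≤ t → (t : EReal) < T → 0 < z t := by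
    intro t h1 h2
    exact aux_pos (k := N - 1) (p := fun t => 3 * x t - y t) (by linarith) h1
      (fun s hs1 hs2 => hx s hs1 (hlt hs2 h2)) (fun s hs1 hs2 => hz s hs1 (hlt hs2 h2)) hx1 hz0
  have hxmono : ∀ s t : ℝ, t₀ ≤ s → s ≤ t → (t : EReal) < T → x s ≤ x t := by
    intro s t h1 h2 h3
    exact aux_mono h2 (fun r hr1 hr2 => hx r (h1.trans hr1) (hlt hr2 h3))
      (fun r hr1 hr2 => (hzpos r (h1.trans hr1) (hlt hr2 h3)).le)
  have hxge : ∀ t : ℝ, t₀ ≤ t → (t : EReal) < T → x t₀ ≤ x t := fun t h1 h2 =>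
    hxmono t₀ t le_rfl h1 h2
  -- `x` is unbounded
  have hunb : ∀ M : ℝ, ∃ t : ℝ, t₀ ≤ t ∧ (t : EReal) < T ∧ M < x t := by
    intro M
    by_cases hT : T = ⊤
    · have hTt : ∀ t : ℝ, (t : EReal) < T := fun t => by rw [hT]; exact EReal.coe_lt_top t
      obtain ⟨k, hk⟩ : ∃ k : ℝ, k = x t₀ ^ 2 - 1 := ⟨_, rfl⟩
      have hkpos : 0 < k := by rw [hk]; nlinarith
      have hw : ∀ t : ℝ, t₀ ≤ t → x t + y t ≤ x t₀ + y t₀ - k * (t - t₀) := by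
        intro t ht
        have := aux_mono (f := fun s => - (x s + y s) - k * s)
          (f' := fun s => - (z s + (x s * y s - N * (x s) ^ 2 - lam * (ω s) ^ 2)) - k * 1) ht
          (fun s h1 _ => (((hx s h1 (hTt s)).add (hy s h1 (hTt s))).neg).sub
            ((hasDerivAt_id s).const_mul k))
          (fun s h1 _ => by
            have h3 := hxge s h1 (hTt s)
            have h4 : k ≤ x s ^ 2 - 1 := by rw [hk]; nlinarith
            have h5 : 0 ≤ lam * (ω s) ^ 2 := by positivity
            rw [hzt]
            nlinarith)
        linarith
      obtain ⟨t₁, ht₁def⟩ : ∃ t₁ : ℝ, t₁ = t₀ + |x t₀ + y t₀| / k := ⟨_, rfl⟩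
      have ht₁ : t₀ ≤ t₁ := by
        have : 0 ≤ |x t₀ + y t₀| / k := by positivity
        linarith
      have hwneg : ∀ t : ℝ, t₁ ≤ t → x t + y t ≤ 0 := by
        intro t ht
        have h1 := hw t (ht₁.trans ht)
        have h2 : k * (t₁ - t₀) = |x t₀ + y t₀| := by
          rw [ht₁def]; field_simp; ring
        have h3 := le_abs_self (x t₀ + y t₀)
        nlinarith
      have hzge : ∀ t : ℝ, t₁ ≤ t → z t₁ ≤ z t := by
        intro t ht
        refine aux_mono ht (fun s h1 _ => hz s (ht₁.trans h1) (hTt s)) (fun s h1 _ => ?_)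
        have h2 := hwneg s h1
        have h3 := hzpos s (ht₁.trans h1) (hTt s)
        have h4 := hxge s (ht₁.trans h1) (hTt s)
        have h5 : 0 ≤ z s * (3 * x s - y s) := mul_nonneg h3.le (by linarith)
        have h6 : 0 ≤ x s ^ 2 - 1 := by nlinarith
        have h7 : 0 ≤ (N - 1) * (x s * (x s ^ 2 - 1)) :=
          mul_nonneg (by linarith) (mul_nonneg (by linarith) h6)
        linarith
      have hz1 := hzpos t₁ ht₁ (hTt _)
      have hxlin : ∀ t : ℝ, t₁ ≤ t → x t₁ + z t₁ * (t - t₁) ≤ x t := by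
        intro t ht
        have := aux_mono (f := fun s => x s - z t₁ * s) (f' := fun s => z s - z t₁ * 1) ht
          (fun s h1 _ => (hx s (ht₁.trans h1) (hTt s)).sub ((hasDerivAt_id s).const_mul _))
          (fun s h1 _ => by have := hzge s h1; linarith)
        linarith
      have hq : 0 ≤ |M| / z t₁ := by positivity
      refine ⟨t₁ + |M| / z t₁, by linarith, hTt _, ?_⟩
      have h1 := hxlin (t₁ + |M| / z t₁) (by linarith)
      have h2 : z t₁ * (t₁ + |M| / z t₁ - t₁) = |M| := by field_simp; ring
      have h3 := le_abs_self M
      have h4 := hxge t₁ ht₁ (hTt _)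
      linarith
    · obtain ⟨t, h1, h2, h3⟩ := hmax hT M
      refine ⟨t, h1.le, h2, ?_⟩
      have := hxge t h1.le h2
      rwa [abs_of_pos (by linarith)] at h3
  -- the quotient c of the derivative of x by the square of x
  obtain ⟨a, ha0, haT, ha3⟩ := hunb 3
  have hx3 : ∀ t : ℝ, a ≤ t → (t : EReal) < T → 3 ≤ x t := fun t h1 h2 =>
    ha3.le.trans (hxmono a t ha0 h1 h2)
  obtain ⟨cd, hcd⟩ : ∃ cd : ℝ → ℝ, cd = fun t =>
    (z t * (3 * x t - y t) + (N - 1) * (x t * (x t ^ 2 - 1))) / x t ^ 2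
      - 2 * z t ^ 2 / x t ^ 3 := ⟨_, rfl⟩
  have hc : ∀ t : ℝ, a ≤ t → (t : EReal) < T → HasDerivAt (fun t => z t / x t ^ 2) (cd t) t := by
    intro t h1 h2
    have hxp : 0 < x t := by linarith [hx3 t h1 h2]
    have h := (hz t (ha0.trans h1) h2).div ((hx t (ha0.trans h1) h2).pow 2)
      (pow_ne_zero 2 hxp.ne')
    refine h.congr_deriv ?_
    rw [hcd]
    simp only [Pi.pow_apply]
    field_simp
    norm_num
    ring
  have hcdge : ∀ t : ℝ, a ≤ t → (t : EReal) < T → z t / x t ^ 2 ≤ 2 → x t / 2 ≤ cd t := by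
    intro t h1 h2 h3
    have hxp : 0 < x t := by linarith [hx3 t h1 h2]
    rw [hcd]
    refine aux_alg hN (hx3 t h1 h2) (u := lam * ω t ^ 2) (by positivity) (hzt t)
      (hzpos t (ha0.trans h1) h2) ?_
    rwa [div_le_iff₀ (by positivity)] at h3
  -- eventually `c ≥ 2`
  have hreach : ∃ b : ℝ, a ≤ b ∧ (b : EReal) < T ∧ 2 ≤ z b / x b ^ 2 := by
    by_contra hno
    push Not at hno
    obtain ⟨t, ht0, htT, htM⟩ := hunb (max (x a) (rexp (Real.log (x a) + 8)))
    have hat : a ≤ t := by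
      by_contra h
      push Not at h
      have := hxmono t a ht0 h.le haT
      have := le_max_left (x a) (rexp (Real.log (x a) + 8))
      linarith
    have := aux_mono (f := fun s => 4 * (z s / x s ^ 2) - Real.log (x s))
      (f' := fun s => 4 * cd s - z s / x s) hat
      (fun s h1 h2 => ((hc s h1 (hlt h2 htT)).const_mul 4).sub
        ((hx s (ha0.trans h1) (hlt h2 htT)).log (by linarith [hx3 s h1 (hlt h2 htT)])))
      (fun s h1 h2 => by
        have hT := hlt h2 htT
        have h3 := hx3 s h1 hT
        have h4 := (hno s h1 hT).le
        have h5 := hcdge s h1 hT h4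
        have hxp : 0 < x s := by linarith
        have h6 : z s / x s = (z s / x s ^ 2) * x s := by field_simp
        rw [h6]
        nlinarith)
    have h1 := hno t hat htT
    have h2 : 0 ≤ z a / x a ^ 2 := div_nonneg (hzpos a ha0 haT).le (by positivity)
    have h3 : Real.log (x a) + 8 < Real.log (x t) := by
      rw [Real.lt_log_iff_exp_lt (by linarith [hx3 t hat htT])]
      exact lt_of_le_of_lt (le_max_right _ _) htM
    linarith
  obtain ⟨b, hab, hbT, hb2⟩ := hreach
  have hc2 : ∀ t : ℝ, b ≤ t → (t : EReal) < T → 2 ≤ z t / x t ^ 2 := by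
    intro t h1 h2
    have := image_le_of_deriv_right_lt_deriv_boundary' (f := fun s => - (z s / x s ^ 2))
      (f' := fun s => - cd s) (a := b) (b := t) (B := fun _ => -2) (B' := fun _ => 0)
      (fun s hs => (hc s (hab.trans hs.1) (hlt hs.2 h2)).neg.continuousAt.continuousWithinAt)
      (fun s hs => (hc s (hab.trans hs.1) (hlt hs.2.le h2)).neg.hasDerivWithinAt)
      (by linarith) continuousOn_const
      (fun s hs => hasDerivWithinAt_const _ _ _)
      (fun s hs he => by
        have hT := hlt hs.2.le h2
        have h5 := hcdge s (hab.trans hs.1) hT (by linarith)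
        have := hx3 s (hab.trans hs.1) hT
        linarith)
      (show t ∈ Icc b t from ⟨h1, le_rfl⟩)
    linarith
  have hfin : IntegrableOn ω {t : ℝ | b < t ∧ (t : EReal) < T} volume := by
    have h0b : t₀ ≤ b := ha0.trans hab
    refine aux_int (G := fun t => ω t / x t)
      (G' := fun t => (x t * ω t * x t - ω t * z t) / x t ^ 2) hbT
      (fun t h1 h2 => (hω t (h0b.trans h1) h2).continuousAt)
      (fun t h1 h2 => (hωpos t (hS (h0b.trans h1)) h2).le)
      (fun t h1 h2 => (hω t (h0b.trans h1) h2).div (hx t (h0b.trans h1) h2)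
        (by linarith [hx3 t (hab.trans h1) h2]))
      (fun t h1 h2 => div_nonneg (hωpos t (hS (h0b.trans h1)) h2).le
        (by linarith [hx3 t (hab.trans h1) h2]))
      (fun t h1 h2 => ?_)
    have h3 := hc2 t h1 h2
    have h4 := hωpos t (hS (h0b.trans h1)) h2
    have h5 := hx3 t (hab.trans h1) h2
    have e : (x t * ω t * x t - ω t * z t) / x t ^ 2 = ω t * (1 - z t / x t ^ 2) := by
      have : 0 < x t := by linarith
      field_simp
    simp only [e]
    nlinarith
  have hcpt : IntegrableOn ω (Icc t₀ b) volume := by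
    apply ContinuousOn.integrableOn_Icc
    intro t ht
    exact (hω t ht.1 (hlt ht.2 hbT)).continuousAt.continuousWithinAt
  refine (hcpt.union hfin).mono_set ?_
  intro t ht
  rcases le_or_gt t b with h | h
  · exact Or.inl ⟨ht.1.le, h⟩
  · exact Or.inr ⟨h, ht.2⟩
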